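/- Let G be a simple graph, c a proper coloring of G, and {u, v} an edge of G such that the set of colors that c assigns to the common neighbors of u and v has cardinality strictly less than k − 2, where k ≥ 2. Then no clique of size k in G contains both u and v; consequently, every clique of size k in G is a clique of size k in the graph obtained from G by deleting the edge {u, v}. -/

import Mathlib

/-- A proper coloring is injective on a clique. -/
theorem SimpleGraph.IsClique.injOn_coloring {V α : Type*} {G : SimpleGraph V} {s : Set V}
    (hs : G.IsClique s) (c : G.Coloring α) : Set.InjOn c s := fun _ hx _ hy hxy =>
  by_contra fun hne => c.valid (hs hx hy hne) hxy

/-- The vertices of a clique other than `u, v ∈ s` are common neighbors of `u` and `v`. -/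
theorem SimpleGraph.IsClique.sdiff_pair_subset_commonNeighbors {V : Type*} {G : SimpleGraph V}
    {s : Set V} (hs : G.IsClique s) {u v : V} (hu : u ∈ s) (hv : v ∈ s) :
    s \ {u, v} ⊆ G.commonNeighbors u v := by
  rintro x ⟨hx, hxuv⟩
  simp only [Set.mem_insert_iff, Set.mem_singleton_iff, not_or] at hxuv
  exact ⟨hs hu hx (Ne.symm hxuv.1), hs hv hx (Ne.symm hxuv.2)⟩

/-- The common neighbors of two vertices of a `k`-clique receive at least `k - 2` colors. -/
theorem SimpleGraph.IsNClique.sub_two_le_ncard_image_commonNeighbors {V α : Type*} [Finite V]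
    {G : SimpleGraph V} {k : ℕ} {s : Finset V} (hs : G.IsNClique k s) (c : G.Coloring α)
    {u v : V} (hu : u ∈ s) (hv : v ∈ s) :
    k - 2 ≤ (c '' G.commonNeighbors u v).ncard := by
  calc k - 2 ≤ (s : Set V).ncard - ({u, v} : Set V).ncard := by
        rw [Set.ncard_coe_finset, hs.card_eq]
        exact Nat.sub_le_sub_left ((Set.ncard_insert_le u {v}).trans (by simp)) k
    _ ≤ ((s : Set V) \ {u, v}).ncard := Set.le_ncard_sdiff _ _
    _ = (c '' ((s : Set V) \ {u, v})).ncard :=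
        (Set.InjOn.ncard_image ((hs.isClique.injOn_coloring c).mono Set.sdiff_subset)).symm
    _ ≤ (c '' G.commonNeighbors u v).ncard :=
        Set.ncard_le_ncard (Set.image_mono
          (hs.isClique.sdiff_pair_subset_commonNeighbors hu hv)) (Set.toFinite _)

/-- A clique not containing both ends of an edge survives the deletion of that edge. -/
theorem SimpleGraph.IsClique.deleteEdges_singleton {V : Type*} {G : SimpleGraph V} {s : Set V}
    (hs : G.IsClique s) {u v : V} (huv : ¬(u ∈ s ∧ v ∈ s)) :
    (G.deleteEdges {s(u, v)}).IsClique s := by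
  intro x hx y hy hxy
  rw [SimpleGraph.deleteEdges_adj, Set.mem_singleton_iff, Sym2.eq_iff]
  refine ⟨hs hx hy hxy, ?_⟩
  rintro (⟨rfl, rfl⟩ | ⟨rfl, rfl⟩)
  · exact huv ⟨hx, hy⟩
  · exact huv ⟨hy, hx⟩

/-- If `{u, v}` is an edge of a finite simple graph `G` and, in some proper coloring `c`
of `G`, the set of colors on the common neighbors of `u` and `v` has cardinality strictly
less than `k - 2` (where `k ≥ 2`), then no clique of size `k` contains both `u` and `v`;
consequently, every clique of size `k` in `G` is a clique of size `k` in the graph obtained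
from `G` by deleting the edge `{u, v}`. -/
theorem edge_pruning_rule {V α : Type*} [Fintype V] (G : SimpleGraph V)
    (c : G.Coloring α) (k : ℕ) (hk : 2 ≤ k) (u v : V) (huv : G.Adj u v)
    (hcol : (⇑c '' G.commonNeighbors u v).ncard < k - 2) :
    (∀ s : Finset V, G.IsNClique k s → ¬(u ∈ s ∧ v ∈ s)) ∧
      (∀ s : Finset V, G.IsNClique k s → (G.deleteEdges {s(u, v)}).IsNClique k s) := by
  have hmem (s : Finset V) (hs : G.IsNClique k s) : ¬(u ∈ s ∧ v ∈ s) := fun h =>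
    hcol.not_ge (hs.sub_two_le_ncard_image_commonNeighbors c h.1 h.2)
  exact ⟨hmem, fun s hs => ⟨hs.isClique.deleteEdges_singleton (hmem s hs), hs.card_eq⟩⟩
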